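/- Let g = Σ_β g_β X^β ∈ R[X₁,…,Xₙ] with g ∉ πR[X₁,…,Xₙ], and set d := max{|β| : |g_β| = 1}. Then for every integer c > totalDegree(g): (i) sup_β |g_β| · |π|^{(d−|β|)/c} = 1 (real exponents, supremum over the support of g); (ii) for a multi-index β in the support of g, the quantity |g_β| · |π|^{(d−|β|)/c} equals 1 if and only if |β| = d and |g_β| = 1, and is strictly less than 1 otherwise. -/

import Mathlib

open Filter

/-- If every nonzero norm is an integer power of `‖π‖`, then an element of norm less than `1` has
norm at most `‖π‖`. -/
lemma norm_le_norm_uniformizer {K : Type*} [NormedField K] {π : K} (hπ0 : π ≠ 0) (hπ1 : ‖π‖ < 1)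
    (hπuni : ∀ x : K, x ≠ 0 → ∃ m : ℤ, ‖x‖ = ‖π‖ ^ m) {x : K} (hx : ‖x‖ < 1) : ‖x‖ ≤ ‖π‖ := by
  have hq := norm_pos_iff.mpr hπ0
  rcases eq_or_ne x 0 with rfl | hx0
  · simp
  · obtain ⟨m, hm⟩ := hπuni x hx0
    have hm1 : 1 ≤ m := by
      by_contra! h
      have := one_le_zpow_of_nonpos₀ hq hπ1.le (show m ≤ 0 by lia)
      linarith
    rw [hm]
    simpa using zpow_right_anti₀ hq hπ1.le hm1

/-- The total exponent of a monomial in the support is at most the total degree. -/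
lemma MvPolynomial.sum_le_totalDegree {σ R : Type*} [Fintype σ] [CommSemiring R]
    {g : MvPolynomial σ R} {β : σ →₀ ℕ} (hβ : β ∈ g.support) : ∑ i, β i ≤ g.totalDegree := by
  have h := MvPolynomial.le_totalDegree hβ
  rwa [Finsupp.sum_fintype _ _ fun _ => rfl] at h

/-- With `K`, `π`, `g`, `d` as before and `c > totalDegree g`:
(i) the supremum over the support of `g` of `‖g_β‖ * ‖π‖^((d−|β|)/c)` (real exponents)
is `1`, and is attained; (ii) for `β` in the support, this quantity equals `1` iff
`|β| = d` and `‖g_β‖ = 1`, and is `< 1` otherwise. -/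
theorem stmt1 (p : ℕ) [Fact p.Prime] {K : Type} [NontriviallyNormedField K]
    [Algebra ℚ_[p] K] [FiniteDimensional ℚ_[p] K]
    (hiso : ∀ x : ℚ_[p], ‖algebraMap ℚ_[p] K x‖ = ‖x‖)
    (π : K) (hπ0 : π ≠ 0) (hπ1 : ‖π‖ < 1)
    (hπuni : ∀ x : K, x ≠ 0 → ∃ m : ℤ, ‖x‖ = ‖π‖ ^ m)
    {n : ℕ} (g : MvPolynomial (Fin n) K)
    (hint : ∀ β : Fin n →₀ ℕ, ‖MvPolynomial.coeff β g‖ ≤ 1)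
    (hnotπ : ¬ ∀ β : Fin n →₀ ℕ, ‖MvPolynomial.coeff β g‖ ≤ ‖π‖)
    (d : ℕ)
    (hd : IsGreatest {m : ℕ | ∃ β : Fin n →₀ ℕ,
        ‖MvPolynomial.coeff β g‖ = 1 ∧ (∑ i, β i) = m} d)
    (c : ℕ) (hc : g.totalDegree < c) :
    IsGreatest
      {x : ℝ | ∃ β ∈ g.support, x = ‖MvPolynomial.coeff β g‖ *
        ‖π‖ ^ (((d : ℝ) - ((∑ i, β i : ℕ) : ℝ)) / (c : ℝ))} 1 ∧
    ∀ β ∈ g.support,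
      (‖MvPolynomial.coeff β g‖ * ‖π‖ ^ (((d : ℝ) - ((∑ i, β i : ℕ) : ℝ)) / (c : ℝ)) = 1 ↔
        ((∑ i, β i) = d ∧ ‖MvPolynomial.coeff β g‖ = 1)) ∧
      (¬ ((∑ i, β i) = d ∧ ‖MvPolynomial.coeff β g‖ = 1) →
        ‖MvPolynomial.coeff β g‖ * ‖π‖ ^ (((d : ℝ) - ((∑ i, β i : ℕ) : ℝ)) / (c : ℝ)) < 1) := by
  have hq : 0 < ‖π‖ := norm_pos_iff.mpr hπ0
  have hc0 : (0 : ℝ) < c := by exact_mod_cast (Nat.zero_le _).trans_lt hc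
  have hone (β : Fin n →₀ ℕ) (h : (∑ i, β i) = d ∧ ‖MvPolynomial.coeff β g‖ = 1) :
      ‖MvPolynomial.coeff β g‖ * ‖π‖ ^ (((d : ℝ) - ((∑ i, β i : ℕ) : ℝ)) / (c : ℝ)) = 1 := by
    rw [h.1, h.2, sub_self, zero_div, Real.rpow_zero, mul_one]
  have hlt (β : Fin n →₀ ℕ) (hβ : β ∈ g.support)
      (h : ¬ ((∑ i, β i) = d ∧ ‖MvPolynomial.coeff β g‖ = 1)) :
      ‖MvPolynomial.coeff β g‖ * ‖π‖ ^ (((d : ℝ) - ((∑ i, β i : ℕ) : ℝ)) / (c : ℝ)) < 1 := by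
    rcases (hint β).eq_or_lt with h1 | h1
    · have hβd : (∑ i, β i) < d := lt_of_le_of_ne (hd.2 ⟨β, h1, rfl⟩) fun e => h ⟨e, h1⟩
      rw [h1, one_mul]
      exact Real.rpow_lt_one hq.le hπ1 (div_pos (sub_pos.mpr (by exact_mod_cast hβd)) hc0)
    · have hβc : ((∑ i, β i : ℕ) : ℝ) < c := by
        exact_mod_cast (MvPolynomial.sum_le_totalDegree hβ).trans_lt hc
      have hexp : 0 < 1 + ((d : ℝ) - ((∑ i, β i : ℕ) : ℝ)) / (c : ℝ) := by
        have : -1 < ((d : ℝ) - ((∑ i, β i : ℕ) : ℝ)) / (c : ℝ) := by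
          rw [lt_div_iff₀ hc0]
          linarith [Nat.cast_nonneg (α := ℝ) d]
        linarith
      calc _ ≤ ‖π‖ * ‖π‖ ^ (((d : ℝ) - ((∑ i, β i : ℕ) : ℝ)) / (c : ℝ)) := by
            gcongr
            exact norm_le_norm_uniformizer hπ0 hπ1 hπuni h1
        _ = ‖π‖ ^ (1 + ((d : ℝ) - ((∑ i, β i : ℕ) : ℝ)) / (c : ℝ)) := by
            rw [Real.rpow_add hq, Real.rpow_one]
        _ < 1 := Real.rpow_lt_one hq.le hπ1 hexp
  refine ⟨⟨?_, ?_⟩, fun β hβ => ⟨⟨fun h => ?_, hone β⟩, hlt β hβ⟩⟩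
  · obtain ⟨β, h1, h2⟩ := hd.1
    refine ⟨β, MvPolynomial.mem_support_iff.mpr fun h0 => ?_, (hone β ⟨h2, h1⟩).symm⟩
    simp [h0] at h1
  · rintro _ ⟨β, hβ, rfl⟩
    by_cases h : (∑ i, β i) = d ∧ ‖MvPolynomial.coeff β g‖ = 1
    · exact (hone β h).le
    · exact (hlt β hβ h).le
  · by_contra h'
    exact (hlt β hβ h').ne h
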